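/- (Square codes, sparse regime) Let (n_k) and (e_k) be sequences of positive integers with n_k → ∞, e_k ≤ (n_k+1)², and e_k = o(n_k) (i.e. e_k/n_k → 0). Then the average of I(E) over all binom((n_k+1)², e_k) error configurations E of the (n_k+1)×(n_k+1) grid with exactly e_k cells tends to 0 as k → ∞. -/

import Mathlib

open Filter Topology

/-- A configuration `E` of cells in the `(n+1) × (m+1)` grid is *good* if every nonempty
subset of `E` contains a cell that is the unique cell of the subset in its row,
or the unique cell of the subset in its column. -/
def IsGood (n m : ℕ) (E : Finset (Fin (n + 1) × Fin (m + 1))) : Prop :=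
  ∀ E'' ⊆ E, E''.Nonempty →
    ∃ c ∈ E'', (∀ c' ∈ E'', c'.1 = c.1 → c' = c) ∨ (∀ c' ∈ E'', c'.2 = c.2 → c' = c)

/-- The coordinates graph of a configuration: the bipartite graph on rows ⊕ columns where
row `i` is adjacent to column `j` iff `(i, j) ∈ E`. -/
def coordGraph (n m : ℕ) (E : Finset (Fin (n + 1) × Fin (m + 1))) :
    SimpleGraph (Fin (n + 1) ⊕ Fin (m + 1)) :=
  SimpleGraph.fromRel (fun u v => ∃ i j, u = Sum.inl i ∧ v = Sum.inr j ∧ (i, j) ∈ E)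

/-- Total number of connected components of the coordinates graph (isolated vertices included). -/
noncomputable def Ncc (n m : ℕ) (E : Finset (Fin (n + 1) × Fin (m + 1))) : ℕ :=
  Nat.card (coordGraph n m E).ConnectedComponent

/-- Number of connected components of the coordinates graph containing at least one edge. -/
noncomputable def Nnscc (n m : ℕ) (E : Finset (Fin (n + 1) × Fin (m + 1))) : ℕ :=
  Set.ncard {c : (coordGraph n m E).ConnectedComponent |
    ∃ u v, (coordGraph n m E).Adj u v ∧ (coordGraph n m E).connectedComponentMk u = c}

/-- Number of rows containing at least one cell of `E`. -/
def rowCount (n m : ℕ) (E : Finset (Fin (n + 1) × Fin (m + 1))) : ℕ :=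
  (E.image Prod.fst).card

/-- Number of columns containing at least one cell of `E`. -/
def colCount (n m : ℕ) (E : Finset (Fin (n + 1) × Fin (m + 1))) : ℕ :=
  (E.image Prod.snd).card

/-- `I(E)`: minimum cardinality of a feedback repair set of `E`, i.e. of a subset
`E' ⊆ E` such that `E \ E'` is a good configuration. -/
noncomputable def minFRS (n m : ℕ) (E : Finset (Fin (n + 1) × Fin (m + 1))) : ℕ :=
  sInf {k | ∃ E' ⊆ E, IsGood n m (E \ E') ∧ E'.card = k}

def pcell {n : ℕ} (i : ℕ) (a b : Fin (n+1)) : Fin (n+1) × Fin (n+1) :=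
  if Even i then (a, b) else (b, a)

def pext {n k : ℕ} (j : Fin k) (w : Fin k → Fin (n+1)) (i : ℕ) : Fin (n+1) :=
  if h : i < k then w ⟨i, h⟩ else w j

def pcells {n k : ℕ} (j : Fin k) (w : Fin k → Fin (n+1)) : Finset (Fin (n+1) × Fin (n+1)) :=
  (Finset.range k).image (fun i => pcell i (pext j w i) (pext j w (i+1)))

lemma exists_first (p : ℕ → Prop) (h : ∃ k, p k) : ∃ k, p k ∧ ∀ a < k, ¬ p a := by
  classical
  exact ⟨Nat.find h, Nat.find_spec h, fun a ha => Nat.find_min h ha⟩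

lemma exists_pattern {n : ℕ} (E : Finset (Fin (n+1) × Fin (n+1))) (h : ¬ IsGood n n E) :
    ∃ (k : ℕ) (j : Fin k) (w : Fin k → Fin (n+1)), (pcells j w).card = k ∧ pcells j w ⊆ E := by
  unfold IsGood at h
  push Not at h
  obtain ⟨F, hFE, ⟨c0, hc0⟩, hF⟩ := h
  have hF1 : ∀ c : F, ∃ c' : F, c'.1.1 = c.1.1 ∧ c' ≠ c := by
    intro c
    obtain ⟨⟨c', h1, h2, h3⟩, -⟩ := hF c.1 c.2
    exact ⟨⟨c', h1⟩, h2, fun h => h3 (congrArg Subtype.val h)⟩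
  have hF2 : ∀ c : F, ∃ c' : F, c'.1.2 = c.1.2 ∧ c' ≠ c := by
    intro c
    obtain ⟨-, ⟨c', h1, h2, h3⟩⟩ := hF c.1 c.2
    exact ⟨⟨c', h1⟩, h2, fun h => h3 (congrArg Subtype.val h)⟩
  choose f hf hf' using hF1
  choose g hg hg' using hF2
  let c : ℕ → F := fun i => Nat.rec ⟨c0, hc0⟩ (fun i x => if Even i then g x else f x) i
  have hc : ∀ i, c (i+1) = if Even i then g (c i) else f (c i) := fun i => rfl
  have hne : ∀ i, c (i+1) ≠ c i := by
    intro i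
    rw [hc]
    split_ifs
    · exact hg' _
    · exact hf' _
  let v : ℕ → Fin (n+1) := fun i => if Even i then (c i).1.1 else (c i).1.2
  have hcv : ∀ i, (c i).1 = pcell i (v i) (v (i+1)) := by
    intro i
    by_cases hi : Even i
    · simp [pcell, v, hi, Nat.even_add_one, hc, hg]
    · simp [pcell, v, hi, Nat.even_add_one, hc, hf]
  have hrep : ∃ k, ∃ j < k, c k = c j := by
    obtain ⟨a, b, hab, h⟩ := Finite.exists_ne_map_eq_of_infinite c
    rcases lt_or_gt_of_ne hab with h1 | h1
    · exact ⟨b, a, h1, h.symm⟩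
    · exact ⟨a, b, h1, h⟩
  classical
  obtain ⟨k, hk0, hk1⟩ : ∃ k, (∃ j < k, c k = c j) ∧ ∀ a < k, ¬ ∃ j < a, c a = c j :=
    exists_first (fun k => ∃ j < k, c k = c j) hrep
  obtain ⟨j, hjk, hj⟩ := hk0
  have hmin : ∀ a < k, ∀ b < a, c a ≠ c b := by
    intro a ha b hb hab
    exact hk1 a ha ⟨b, hb, hab⟩
  obtain ⟨j', hj'⟩ : ∃ j' : Fin k, v k = v j' := by
    by_cases hp : Even k ↔ Even j
    · refine ⟨⟨j, hjk⟩, ?_⟩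
      simp only [v, hj, hp]
    · have hjk1 : j + 1 ≠ k := by
        intro h
        rw [← h] at hj
        exact hne j hj
      refine ⟨⟨j+1, by omega⟩, ?_⟩
      have h1 := hcv j
      have h2 := hcv k
      rw [hj, h1] at h2
      by_cases hk : Even k <;> by_cases hjj : Even j <;> simp [hk, hjj, pcell] at hp h2 ⊢
      · exact h2.1.symm
      · exact h2.2.symm
  have hext : ∀ i ≤ k, pext j' (fun i : Fin k => v i) i = v i := by
    intro i hi
    unfold pext
    split_ifs with h
    · rfl
    · have hik : i = k := by omega
      rw [hik]
      exact hj'.symm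
  have hP : pcells j' (fun i : Fin k => v i) = (Finset.range k).image (fun i => (c i).1) := by
    apply Finset.image_congr
    intro i hi
    have hi : i < k := by simpa using hi
    show pcell _ _ _ = _
    rw [hext i (by omega), hext (i+1) (by omega)]
    exact (hcv i).symm
  refine ⟨k, j', fun i => v i, ?_, ?_⟩
  · rw [hP, Finset.card_image_of_injOn, Finset.card_range]
    intro a ha b hb hab
    have ha : a < k := by simpa using ha
    have hb : b < k := by simpa using hb
    have hab : c a = c b := Subtype.ext hab
    rcases lt_trichotomy a b with h | h | h
    · exact absurd hab.symm (hmin b hb a h)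
    · exact h
    · exact absurd hab (hmin a ha b h)
  · rw [hP]
    intro x hx
    obtain ⟨i, -, rfl⟩ := Finset.mem_image.1 hx
    exact hFE (c i).2

abbrev Pat (n e : ℕ) := Σ k : Fin (e+1), Fin k × (Fin k → Fin (n+1))

lemma minFRS_le {n : ℕ} (E : Finset (Fin (n+1) × Fin (n+1))) :
    minFRS n n E ≤ ((Finset.univ : Finset (Pat n E.card)).filter
      (fun p => (pcells p.2.1 p.2.2).card = p.1 ∧ pcells p.2.1 p.2.2 ⊆ E)).card := by
  classical
  set T := ((Finset.univ : Finset (Pat n E.card)).filter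
      (fun p => (pcells p.2.1 p.2.2).card = p.1 ∧ pcells p.2.1 p.2.2 ⊆ E)) with hT
  have hch : ∀ p : Pat n E.card, ∃ x, x ∈ pcells p.2.1 p.2.2 := by
    intro p
    refine ⟨_, Finset.mem_image_of_mem _ (Finset.mem_range.2 p.2.1.pos)⟩
  choose ch hch using hch
  refine le_trans (Nat.sInf_le ⟨T.image ch, ?_, ?_, rfl⟩) Finset.card_image_le
  · intro x hx
    obtain ⟨p, hp, rfl⟩ := Finset.mem_image.1 hx
    exact (Finset.mem_filter.1 hp).2.2 (hch p)
  · by_contra hbad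
    obtain ⟨k, j, w, h1, h2⟩ := exists_pattern _ hbad
    have h3 := h2.trans Finset.sdiff_subset
    have hk : k < E.card + 1 := by
      have := Finset.card_le_card h3
      omega
    let p : Pat n E.card := ⟨⟨k, hk⟩, j, w⟩
    have hp : p ∈ T := Finset.mem_filter.2 ⟨Finset.mem_univ _, h1, h3⟩
    have h4 := h2 (hch p)
    exact (Finset.mem_sdiff.1 h4).2 (Finset.mem_image_of_mem _ hp)

lemma choose_pow_le (N e : ℕ) (he : e ≤ N) (s : ℕ) :
    e.choose s * N ^ s ≤ N.choose s * e ^ s := by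
  have key : e.descFactorial s * N ^ s ≤ N.descFactorial s * e ^ s := by
    induction s with
    | zero => simp
    | succ s ih =>
      rw [Nat.descFactorial_succ, Nat.descFactorial_succ, pow_succ, pow_succ]
      have h : (e - s) * N ≤ (N - s) * e := by
        rw [Nat.sub_mul, Nat.sub_mul, mul_comm e N]
        exact Nat.sub_le_sub_left (Nat.mul_le_mul_left _ he) _
      calc _ = ((e - s) * N) * (e.descFactorial s * N ^ s) := by ring
        _ ≤ ((N - s) * e) * (N.descFactorial s * e ^ s) := Nat.mul_le_mul h ih
        _ = _ := by ring
  rw [Nat.descFactorial_eq_factorial_mul_choose, Nat.descFactorial_eq_factorial_mul_choose,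
    mul_assoc, mul_assoc] at key
  exact Nat.le_of_mul_le_mul_left key (Nat.factorial_pos s)

lemma card_superset {α : Type*} [Fintype α] [DecidableEq α] (S : Finset α) (e : ℕ)
    (hs : S.card ≤ e) (he : e ≤ Fintype.card α) :
    ((Finset.powersetCard e (Finset.univ : Finset α)).filter (fun E => S ⊆ E)).card
      * Fintype.card α ^ S.card ≤ e ^ S.card * (Fintype.card α).choose e := by
  have h1 : ((Finset.powersetCard e (Finset.univ : Finset α)).filter (fun E => S ⊆ E)).card
      ≤ (Fintype.card α - S.card).choose (e - S.card) := by
    rw [← Finset.card_compl, ← Finset.card_powersetCard]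
    apply Finset.card_le_card_of_injOn (fun E => E \ S)
    · intro E hE
      simp only [Finset.coe_filter, Finset.mem_powersetCard, Set.mem_ofPred_eq] at hE
      simp only [Finset.mem_coe, Finset.mem_powersetCard]
      refine ⟨fun x hx => ?_, ?_⟩
      · simp at hx ⊢; exact hx.2
      · rw [Finset.card_sdiff_of_subset hE.2, hE.1.2]
    · intro E hE F hF h
      simp only [Finset.coe_filter, Set.mem_ofPred_eq] at hE hF
      have h : E \ S = F \ S := h
      rw [← Finset.sdiff_union_of_subset hE.2, h, Finset.sdiff_union_of_subset hF.2]
  have h2 := Nat.choose_mul (n := Fintype.card α) hs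
  have h3 := choose_pow_le _ _ he S.card
  have h4 : 0 < (Fintype.card α).choose S.card := Nat.choose_pos (hs.trans he)
  refine le_trans (Nat.mul_le_mul_right _ h1) ?_
  refine Nat.le_of_mul_le_mul_left ?_ h4
  rw [← mul_assoc, ← h2]
  calc _ = (Fintype.card α).choose e * (e.choose S.card * Fintype.card α ^ S.card) := by ring
    _ ≤ (Fintype.card α).choose e * ((Fintype.card α).choose S.card * e ^ S.card) :=
      Nat.mul_le_mul_left _ h3
    _ = _ := by ring

lemma sum_bound (n e : ℕ) (he : e ≤ (n+1)^2) :
    (∑ E ∈ Finset.powersetCard e (Finset.univ : Finset (Fin (n + 1) × Fin (n + 1))),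
            (minFRS n n E : ℝ)) ≤
      (∑ k ∈ Finset.range (e+1), (k : ℝ) * ((e : ℝ) / (n+1)) ^ k) * (Nat.choose ((n+1)^2) e : ℝ) := by
  classical
  have hcard : Fintype.card (Fin (n + 1) × Fin (n + 1)) = (n+1)^2 := by simp [sq]
  set U := Finset.powersetCard e (Finset.univ : Finset (Fin (n + 1) × Fin (n + 1))) with hU
  have h1 : (∑ E ∈ U, (minFRS n n E : ℝ)) ≤ ∑ E ∈ U, ∑ p : Pat n e,
      if (pcells p.2.1 p.2.2).card = p.1 ∧ pcells p.2.1 p.2.2 ⊆ E then (1:ℝ) else 0 := by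
    apply Finset.sum_le_sum
    intro E hE
    have hE : E.card = e := (Finset.mem_powersetCard.1 hE).2
    subst hE
    rw [Finset.sum_boole]
    exact_mod_cast minFRS_le E
  refine h1.trans ?_
  rw [Finset.sum_comm]
  have h2 : ∀ p : Pat n e, (∑ E ∈ U,
      if (pcells p.2.1 p.2.2).card = p.1 ∧ pcells p.2.1 p.2.2 ⊆ E then (1:ℝ) else 0) ≤
      ((e:ℝ) / (n+1)^2) ^ (p.1 : ℕ) * (Nat.choose ((n+1)^2) e : ℝ) := by
    intro p
    by_cases hp : (pcells p.2.1 p.2.2).card = p.1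
    · simp only [hp, true_and]
      rw [Finset.sum_boole]
      have := card_superset (pcells p.2.1 p.2.2) e (by rw [hp]; exact Nat.lt_succ_iff.1 p.1.2)
        (by rw [hcard]; exact he)
      rw [hcard, hp] at this
      rw [div_pow, div_mul_eq_mul_div, le_div_iff₀ (by positivity)]
      exact_mod_cast this
    · simp only [hp, false_and, if_false, Finset.sum_const_zero]
      positivity
  refine (Finset.sum_le_sum (fun p _ => h2 p)).trans ?_
  rw [← Finset.sum_mul, Fintype.sum_sigma, Finset.sum_range]
  apply le_of_eq
  congr 1
  apply Finset.sum_congr rfl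
  intro k _
  simp only [Finset.sum_const, Finset.card_univ, Fintype.card_prod, Fintype.card_fun,
    Fintype.card_fin, nsmul_eq_mul, Nat.cast_mul, Nat.cast_pow, Nat.cast_add, Nat.cast_one]
  rw [mul_assoc, ← mul_pow]
  congr 2
  field_simp

/-- Square codes, sparse regime: if `n_k → ∞` and `e_k = o(n_k)`, the average of `I(E)` over
all `e_k`-cell configurations of the `(n_k+1) × (n_k+1)` grid tends to `0`. -/
theorem square_sparse (n e : ℕ → ℕ)
    (hn : Tendsto n atTop atTop)
    (hpos : ∀ k, 0 < n k ∧ 0 < e k)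
    (hle : ∀ k, e k ≤ (n k + 1) ^ 2)
    (hsmall : Tendsto (fun k => ((e k : ℝ) / (n k : ℝ))) atTop (nhds 0)) :
    Tendsto
      (fun k =>
        (∑ E ∈ Finset.powersetCard (e k)
            (Finset.univ : Finset (Fin (n k + 1) × Fin (n k + 1))),
            (minFRS (n k) (n k) E : ℝ)) /
          (Nat.choose ((n k + 1) ^ 2) (e k) : ℝ))
      atTop (nhds 0) := by
  have hx : Tendsto (fun k => (e k : ℝ) / ((n k : ℝ) + 1)) atTop (nhds 0) := by
    refine squeeze_zero (fun k => by positivity) (fun k => ?_) hsmall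
    have : (0:ℝ) < n k := by exact_mod_cast (hpos k).1
    gcongr
    linarith
  have hlim : Tendsto (fun k => ((e k : ℝ) / ((n k : ℝ) + 1)) /
      (1 - (e k : ℝ) / ((n k : ℝ) + 1)) ^ 2) atTop (nhds 0) := by
    have := hx.div ((tendsto_const_nhds (x := (1:ℝ)).sub hx).pow 2) (by norm_num)
    simp only [sub_zero, one_pow, div_one] at this
    exact this
  refine squeeze_zero' (Eventually.of_forall fun k => by positivity) ?_ hlim
  filter_upwards [hx.eventually (gt_mem_nhds one_pos)] with k hk
  have hc : (0:ℝ) < (Nat.choose ((n k + 1) ^ 2) (e k) : ℝ) := by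
    exact_mod_cast Nat.choose_pos (hle k)
  rw [div_le_iff₀ hc]
  refine (sum_bound _ _ (hle k)).trans ?_
  gcongr
  have h0 : (0:ℝ) ≤ (e k : ℝ) / ((n k : ℝ) + 1) := by positivity
  refine sum_le_hasSum _ (fun i _ => by positivity)
    (hasSum_coe_mul_geometric_of_norm_lt_one (by rwa [Real.norm_of_nonneg h0]))
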